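/- Let n, K be positive integers, X a nonempty finite subset of {0,1}^n, and for each i ∈ [n] let p_{i0},…,p_{iK} be nonnegative reals summing to 1. Let Θ be the set of joint distributions θ on {0,…,K}^n with P_θ(c̃_i = k) = p_{ik} for all i, k, and Z(c) = max_{x∈X} cᵀx. Then the maximum over θ ∈ Θ of E_θ[Z(c̃)] equals the optimal value of the linear program: maximize Σ_{i=1}^n Σ_{k=0}^K k · γ_{ik} p_{ik} over variables γ_{ik} ∈ [0,1] (i ∈ [n], k ∈ {0,…,K}) and λ_x ≥ 0 (x ∈ X) subject to Σ_{x∈X} λ_x = 1 and Σ_{k=0}^K p_{ik} γ_{ik} = Σ_{x∈X: x_i = 1} λ_x for every i ∈ [n]. -/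

import Mathlib

open Finset

/-- A nonnegative weight with total mass `s` is `s` times a probability vector. -/
lemma exists_normalization {κ : Type*} [Fintype κ] [Nonempty κ] (w : κ → ℝ) (hw : ∀ k, 0 ≤ w k) :
    ∃ f : κ → ℝ, (∀ k, 0 ≤ f k) ∧ ∑ k, f k = 1 ∧ ∀ k, (∑ l, w l) * f k = w k := by
  classical
  rcases eq_or_ne (∑ l, w l) 0 with h | h
  · have hz := (Finset.sum_eq_zero_iff_of_nonneg fun k _ => hw k).1 h
    refine ⟨Pi.single (Classical.arbitrary κ) 1, fun k => ?_, by simp, fun k => ?_⟩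
    · by_cases hk : k = Classical.arbitrary κ
      · subst hk; simp
      · simp [hk]
    · rw [h, hz k (mem_univ k), zero_mul]
  · refine ⟨fun k => w k / ∑ l, w l, fun k => div_nonneg (hw k) (sum_nonneg fun l _ => hw l), ?_,
      fun k => mul_div_cancel₀ _ h⟩
    rw [← Finset.sum_div, div_self h]

/-- Under a product of probability vectors, the total mass is one. -/
lemma sum_prod_eq_one {ι κ : Type*} [Fintype ι] [DecidableEq ι] [Fintype κ]
    (f : ι → κ → ℝ) (hf : ∀ i, ∑ k, f i k = 1) : ∑ c : ι → κ, ∏ j, f j (c j) = 1 := by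
  have h := Finset.prod_univ_sum (fun _ : ι => (univ : Finset κ)) f
  rw [Fintype.piFinset_univ] at h
  rw [← h]
  simp [hf]

/-- Under a product of probability vectors, the expectation of a function of one coordinate
is computed with the corresponding factor. -/
lemma sum_prod_mul_apply {ι κ : Type*} [Fintype ι] [DecidableEq ι] [Fintype κ]
    (f : ι → κ → ℝ) (hf : ∀ i, ∑ k, f i k = 1) (i : ι) (g : κ → ℝ) :
    ∑ c : ι → κ, (∏ j, f j (c j)) * g (c i) = ∑ k, f i k * g k := by
  have h := Finset.prod_univ_sum (fun _ : ι => (univ : Finset κ))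
    (fun j k => f j k * if j = i then g k else 1)
  rw [Fintype.piFinset_univ] at h
  simp only [Finset.prod_mul_distrib, Finset.prod_ite_eq', mem_univ, if_true] at h
  rw [← h, Fintype.prod_eq_single i fun j hj => by simp [hj, hf]]
  simp

/-- Splitting an expectation over subsets according to membership of one element. -/
lemma sum_mul_apply_bool {ι : Type*} (X : Finset (ι → Bool)) (lam : (ι → Bool) → ℝ)
    (hlam : ∑ x ∈ X, lam x = 1) (i : ι) (h : Bool → ℝ) :
    ∑ x ∈ X, lam x * h (x i) = (∑ x ∈ X with x i = true, lam x) * h true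
      + (1 - ∑ x ∈ X with x i = true, lam x) * h false := by
  rw [← hlam, Finset.sum_filter, ← Finset.sum_sub_distrib, Finset.sum_mul, Finset.sum_mul,
    ← Finset.sum_add_distrib]
  refine Finset.sum_congr rfl fun x _ => ?_
  cases x i <;> simp

/-- Every joint distribution yields a feasible point of the linear program with the same value. -/
lemma exists_lp_point_of_joint {n K : ℕ} (X : Finset (Fin n → Bool)) (hX : X.Nonempty)
    (p : Fin n → Fin (K + 1) → ℝ) (θ : (Fin n → Fin (K + 1)) → ℝ)
    (hθ : ∀ c, 0 ≤ θ c) (hθ1 : ∑ c, θ c = 1)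
    (hm : ∀ i k, ∑ c with c i = k, θ c = p i k) :
    ∃ (γ : Fin n → Fin (K + 1) → ℝ) (lam : (Fin n → Bool) → ℝ),
      (∀ i k, 0 ≤ γ i k ∧ γ i k ≤ 1) ∧ (∀ x ∈ X, 0 ≤ lam x) ∧ (∑ x ∈ X, lam x) = 1 ∧
      (∀ i, (∑ k, p i k * γ i k) = ∑ x ∈ X.filter (fun x => x i = true), lam x) ∧
      ∑ c : Fin n → Fin (K + 1), θ c *
          ((X.sup' hX (fun x => ∑ i, if x i then (c i : ℕ) else 0) : ℕ) : ℝ)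
        = ∑ i, ∑ k : Fin (K + 1), ((k : ℕ) : ℝ) * γ i k * p i k := by
  choose y hyX hy using fun c : Fin n → Fin (K + 1) =>
    Finset.exists_mem_eq_sup' hX (fun x => ∑ i, if x i then (c i : ℕ) else 0)
  let a : Fin n → Fin (K + 1) → ℝ := fun i k => ∑ c with c i = k, if y c i then θ c else 0
  have ha0 : ∀ i k, 0 ≤ a i k := fun i k =>
    Finset.sum_nonneg fun c _ => by split_ifs <;> simp [hθ]
  have hap : ∀ i k, a i k ≤ p i k := fun i k => by
    rw [← hm i k]
    exact Finset.sum_le_sum fun c _ => by split_ifs <;> simp [hθ]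
  have hpa : ∀ i k, p i k * (a i k / p i k) = a i k := fun i k => by
    rcases eq_or_ne (p i k) 0 with h | h
    · rw [h, zero_mul]
      exact le_antisymm (ha0 i k) (h ▸ hap i k)
    · exact mul_div_cancel₀ _ h
  refine ⟨fun i k => a i k / p i k, fun x => ∑ c with y c = x, θ c, fun i k => ⟨?_, ?_⟩,
    fun x _ => Finset.sum_nonneg fun c _ => hθ c, ?_, fun i => ?_, ?_⟩
  · exact div_nonneg (ha0 i k) ((ha0 i k).trans (hap i k))
  · exact div_le_one_of_le₀ (hap i k) ((ha0 i k).trans (hap i k))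
  · rw [Finset.sum_fiberwise_of_maps_to fun c _ => hyX c, hθ1]
  · simp only [hpa, a]
    rw [Finset.sum_fiberwise]
    simp only [Finset.sum_filter]
    rw [← Finset.sum_filter (s := X), Finset.sum_comm]
    exact Finset.sum_congr rfl fun c _ => by simp [hyX]
  · have hterm : ∀ i (k : Fin (K + 1)),
        ((k : ℕ) : ℝ) * (a i k / p i k) * p i k
          = ∑ c with c i = k, if y c i then θ c * ((c i : ℕ) : ℝ) else 0 := fun i k => by
      rw [mul_assoc, mul_comm _ (p i k), hpa, Finset.mul_sum]
      refine Finset.sum_congr rfl fun c hc => ?_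
      rw [(Finset.mem_filter.1 hc).2]
      split_ifs <;> ring
    simp only [hterm, Finset.sum_fiberwise]
    rw [Finset.sum_comm]
    refine Finset.sum_congr rfl fun c _ => ?_
    rw [hy c]
    push_cast
    rw [Finset.mul_sum]
    exact Finset.sum_congr rfl fun i _ => by split_ifs <;> simp

/-- Every feasible point of the linear program yields a joint distribution whose expected
optimal value is at least as large. -/
lemma exists_joint_of_lp_point {n K : ℕ} (X : Finset (Fin n → Bool)) (hX : X.Nonempty)
    (p : Fin n → Fin (K + 1) → ℝ) (hp0 : ∀ i k, 0 ≤ p i k) (hp1 : ∀ i, ∑ k, p i k = 1)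
    (γ : Fin n → Fin (K + 1) → ℝ) (lam : (Fin n → Bool) → ℝ)
    (hγ : ∀ i k, 0 ≤ γ i k ∧ γ i k ≤ 1) (hlam : ∀ x ∈ X, 0 ≤ lam x)
    (hlam1 : ∑ x ∈ X, lam x = 1)
    (hq : ∀ i, (∑ k, p i k * γ i k) = ∑ x ∈ X.filter (fun x => x i = true), lam x) :
    ∃ θ : (Fin n → Fin (K + 1)) → ℝ, (∀ c, 0 ≤ θ c) ∧ (∑ c, θ c) = 1 ∧
      (∀ i k, ∑ c ∈ univ.filter (fun c : Fin n → Fin (K + 1) => c i = k), θ c = p i k) ∧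
      ∑ i, ∑ k : Fin (K + 1), ((k : ℕ) : ℝ) * γ i k * p i k ≤
        ∑ c : Fin n → Fin (K + 1), θ c *
          ((X.sup' hX (fun x => ∑ i, if x i then (c i : ℕ) else 0) : ℕ) : ℝ) := by
  choose f hf0 hf1 hf using fun (i : Fin n) (b : Bool) =>
    exists_normalization (fun k => p i k * if b then γ i k else 1 - γ i k) fun k =>
      mul_nonneg (hp0 i k) (by split_ifs <;> linarith [hγ i k])
  have hft : ∀ i k, (∑ x ∈ X with x i = true, lam x) * f i true k = p i k * γ i k :=
    fun i k => by
      rw [← hq]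
      simpa using hf i true k
  have hff : ∀ i k, (1 - ∑ x ∈ X with x i = true, lam x) * f i false k = p i k * (1 - γ i k) :=
    fun i k => by
      rw [← hq, ← hp1 i, ← Finset.sum_sub_distrib]
      simpa [mul_sub, hp1] using hf i false k
  have hexp : ∀ (i : Fin n) (g : Bool → Fin (K + 1) → ℝ),
      ∑ c : Fin n → Fin (K + 1), ∑ x ∈ X, lam x * ((∏ j, f j (x j) (c j)) * g (x i) (c i))
        = ∑ k, (p i k * γ i k * g true k + p i k * (1 - γ i k) * g false k) := fun i g => by
    rw [Finset.sum_comm]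
    simp only [← Finset.mul_sum]
    simp only [fun x : Fin n → Bool => sum_prod_mul_apply (fun j => f j (x j))
      (fun j => hf1 j (x j)) i (g (x i))]
    rw [sum_mul_apply_bool X lam hlam1 i (fun b => ∑ k, f i b k * g b k), Finset.mul_sum,
      Finset.mul_sum, ← Finset.sum_add_distrib]
    simp only [← mul_assoc, hft, hff]
  have hprod : ∀ (x : Fin n → Bool) (c : Fin n → Fin (K + 1)), 0 ≤ ∏ j, f j (x j) (c j) :=
    fun x c => Finset.prod_nonneg fun j _ => hf0 j (x j) (c j)
  refine ⟨fun c => ∑ x ∈ X, lam x * ∏ j, f j (x j) (c j), fun c =>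
    Finset.sum_nonneg fun x hx => mul_nonneg (hlam x hx) (hprod x c), ?_, fun i k => ?_, ?_⟩
  · rw [Finset.sum_comm]
    simp only [← Finset.mul_sum]
    simp only [fun x : Fin n → Bool => sum_prod_eq_one (fun j => f j (x j))
      (fun j => hf1 j (x j)), mul_one, hlam1]
  · have h := hexp i (fun _ l => if l = k then 1 else 0)
    simp only [mul_ite, mul_one, mul_zero] at h
    rw [Finset.sum_filter]
    calc _ = _ := Finset.sum_congr rfl fun c _ => by split_ifs <;> simp
      _ = _ := h
      _ = p i k := by
        simp only [Finset.sum_add_distrib, Finset.sum_ite_eq', mem_univ, if_true]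
        ring
  · calc ∑ i, ∑ k : Fin (K + 1), ((k : ℕ) : ℝ) * γ i k * p i k
        = ∑ i, ∑ c : Fin n → Fin (K + 1), ∑ x ∈ X, lam x * ((∏ j, f j (x j) (c j)) *
            if x i then ((c i : ℕ) : ℝ) else 0) := by
          refine Finset.sum_congr rfl fun i _ => ?_
          rw [hexp i (fun b k => if b then ((k : ℕ) : ℝ) else 0)]
          exact Finset.sum_congr rfl fun k _ => by simp; ring
      _ = ∑ c : Fin n → Fin (K + 1), ∑ x ∈ X, lam x * (∏ j, f j (x j) (c j)) *
            ((∑ i, if x i then (c i : ℕ) else 0 : ℕ) : ℝ) := by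
          rw [Finset.sum_comm]
          refine Finset.sum_congr rfl fun c _ => ?_
          rw [Finset.sum_comm]
          refine Finset.sum_congr rfl fun x _ => ?_
          push_cast
          rw [Finset.mul_sum]
          exact Finset.sum_congr rfl fun i _ => (mul_assoc _ _ _).symm
      _ ≤ _ := by
          refine Finset.sum_le_sum fun c _ => ?_
          rw [Finset.sum_mul]
          refine Finset.sum_le_sum fun x hx => ?_
          refine mul_le_mul_of_nonneg_left ?_ (mul_nonneg (hlam x hx) (hprod x c))
          exact_mod_cast Finset.le_sup' (fun x => ∑ i, if x i then (c i : ℕ) else 0) hx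

/-- Meilijson–Nádas bound in primal LP form: the tightest upper bound on the
expected optimal value `E_θ[Z(c̃)]`, with `Z(c) = max_{x ∈ X} cᵀx`, over all joint
distributions on `{0,…,K}^n` with the given marginals, equals the optimal value of
the stated linear program in the variables `γ i k ∈ [0,1]` and `λ x ≥ 0`. -/
theorem max_expectation_compact_LP (n K : ℕ) (hn : 0 < n) (hK : 0 < K)
    (X : Finset (Fin n → Bool)) (hX : X.Nonempty)
    (p : Fin n → Fin (K + 1) → ℝ) (hp0 : ∀ i k, 0 ≤ p i k) (hp1 : ∀ i, (∑ k, p i k) = 1) :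
    sSup {M : ℝ | ∃ θ : (Fin n → Fin (K + 1)) → ℝ,
        (∀ c, 0 ≤ θ c) ∧ (∑ c, θ c) = 1 ∧
        (∀ i k, ∑ c ∈ univ.filter (fun c : Fin n → Fin (K + 1) => c i = k), θ c = p i k) ∧
        M = ∑ c : Fin n → Fin (K + 1), θ c *
              ((X.sup' hX (fun x => ∑ i, if x i then (c i : ℕ) else 0) : ℕ) : ℝ)}
    = sSup {M : ℝ | ∃ (γ : Fin n → Fin (K + 1) → ℝ) (lam : (Fin n → Bool) → ℝ),
        (∀ i k, 0 ≤ γ i k ∧ γ i k ≤ 1) ∧ (∀ x ∈ X, 0 ≤ lam x) ∧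
        (∑ x ∈ X, lam x) = 1 ∧
        (∀ i, (∑ k, p i k * γ i k) = ∑ x ∈ X.filter (fun x => x i = true), lam x) ∧
        M = ∑ i, ∑ k : Fin (K + 1), ((k : ℕ) : ℝ) * γ i k * p i k} := by
  set A := {M : ℝ | ∃ θ : (Fin n → Fin (K + 1)) → ℝ, _}
  set B := {M : ℝ | ∃ (γ : Fin n → Fin (K + 1) → ℝ) (lam : (Fin n → Bool) → ℝ), _}
  have hsub : A ⊆ B := by
    rintro M ⟨θ, hθ, hθ1, hm, rfl⟩
    exact exists_lp_point_of_joint X hX p θ hθ hθ1 hm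
  have hdom : ∀ M ∈ B, ∃ M' ∈ A, M ≤ M' := by
    rintro M ⟨γ, lam, hγ, hlam, hlam1, hq, rfl⟩
    obtain ⟨θ, hθ, hθ1, hm, hle⟩ :=
      exists_joint_of_lp_point X hX p hp0 hp1 γ lam hγ hlam hlam1 hq
    exact ⟨_, ⟨θ, hθ, hθ1, hm, rfl⟩, hle⟩
  have hBdd : BddAbove B := by
    refine ⟨∑ i, ∑ k : Fin (K + 1), ((k : ℕ) : ℝ) * 1 * p i k, ?_⟩
    rintro M ⟨γ, lam, hγ, -, -, -, rfl⟩
    exact Finset.sum_le_sum fun i _ => Finset.sum_le_sum fun k _ =>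
      mul_le_mul_of_nonneg_right (mul_le_mul_of_nonneg_left (hγ i k).2 (Nat.cast_nonneg _))
        (hp0 i k)
  have hBne : B.Nonempty := by
    obtain ⟨y, hy⟩ := hX
    refine ⟨_, fun i _ => if y i then 1 else 0, fun x => if x = y then 1 else 0,
      fun i k => by dsimp only; split_ifs <;> simp,
      fun x _ => by dsimp only; split_ifs <;> simp, by simp [hy],
      fun i => ?_, rfl⟩
    rw [← Finset.sum_mul, hp1 i]
    simp [hy]
  obtain ⟨M₀, hM₀⟩ := hBne
  obtain ⟨M₁, hM₁, -⟩ := hdom M₀ hM₀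
  refine le_antisymm (csSup_le_csSup hBdd ⟨M₁, hM₁⟩ hsub) (csSup_le ⟨M₀, hM₀⟩ fun M hM => ?_)
  obtain ⟨M', hM', hle⟩ := hdom M hM
  exact le_csSup_of_le (hBdd.mono hsub) hM' hle
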